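/- There exists a constant C > 0, depending only on the kernel (K0, a, δ) and on m, and for every L ≥ L0 and A_L > 0 a constant C_L > 0, with the following property. Let ρ ∈ (0,ρ0) with ρ < min{δ, a/2, 1/2}, and let h ∈ X_{L,ρ} satisfy 1/2 ≤ Q[h](y) ≤ 3/2 for all y < Lρ, |h(x)| ≤ 2·e^{λ(x)} for all x ∈ ℝ, and |(h(x) − h(x−τ))/τ| ≤ (A_L/ρ)·e^{−(1/2)(x−Lρ)} for all x ≥ Lρ and all τ ∈ (0,ρ). Then |H(x)| ≤ (C_L·ρ + C·e^{−aL})·e^{−(3/2)(x−Lρ)} for all x ≥ Lρ. -/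

import Mathlib

open Set MeasureTheory Filter

/-- The weight exponent ω. -/
noncomputable def omegaFn (m L ρ x : ℝ) : ℝ :=
  if x ≤ -(L*ρ) then m/ρ*(x+L*ρ) else if x < L*ρ then 0 else -(1/2)*(x - L*ρ)

/-- The norm on the space X_{L,ρ}. -/
noncomputable def normX (m L ρ : ℝ) (h : ℝ → ℝ) : ℝ :=
  ⨆ x : ℝ, |h x| * Real.exp (-(omegaFn m L ρ x))

/-- Membership in the space X_{L,ρ}. -/
def memX (a m L ρ : ℝ) (h : ℝ → ℝ) : Prop :=
  ContinuousOn h {x : ℝ | x ≠ L*ρ} ∧ (∫ x : ℝ, h x) = 1 ∧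
  (1/ρ) * (∫ x : ℝ, Real.exp (-(a/ρ)*x) * h x) = 1/(1+ρ) ∧
  ∀ x : ℝ, |h x| ≤ 2 * Real.exp (omegaFn m L ρ x)

/-- The hypotheses on the coagulation kernel K. -/
def KernelHyp (K : ℝ → ℝ → ℝ) (γ a K0 δ : ℝ) : Prop :=
  γ < 1 ∧ a = 1 - γ ∧
  ContinuousOn (fun p : ℝ × ℝ => K p.1 p.2) (Ioi 0 ×ˢ Ioi 0) ∧
  (∀ x y : ℝ, 0 < x → 0 < y → 0 ≤ K x y) ∧
  (∀ x y : ℝ, 0 < x → 0 < y → K x y = K y x) ∧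
  (∀ x y α : ℝ, 0 < x → 0 < y → 0 < α → K (α*x) (α*y) = α ^ γ * K x y) ∧
  0 < K0 ∧ δ ∈ Ioo 0 (min 1 a) ∧
  ∀ x ∈ Ioo (0:ℝ) 2, |x ^ a * K x 1 - 1| ≤ K0 * x ^ δ

/-- The hypotheses on the fixed parameters m, L0, ρ0. -/
def ParamHyp (a m L0 ρ0 : ℝ) : Prop :=
  max (a+1) (3*a) < m ∧ (1/a) * Real.log (4*m) < L0 ∧ ρ0 ∈ Ioo (0:ℝ) 1

/-- The function Q[h]. -/
noncomputable def Qfun (K : ℝ → ℝ → ℝ) (a ρ : ℝ) (h : ℝ → ℝ) (y : ℝ) : ℝ :=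
  ∫ z : ℝ, Real.exp (a/ρ*(y-z)) * K (Real.exp ((y-z)/ρ)) 1 * h z

/-- The function ψ_ρ[h]. -/
noncomputable def psiFn (K : ℝ → ℝ → ℝ) (a L ρ : ℝ) (h : ℝ → ℝ) (x : ℝ) : ℝ :=
  (1/ρ) * ∫ y in Ioo x (L*ρ), Real.exp (-(a/ρ)*y) * Qfun K a ρ h y

/-- The remainder R[h]. -/
noncomputable def Rfun (K : ℝ → ℝ → ℝ) (a L ρ : ℝ) (h : ℝ → ℝ) (x : ℝ) : ℝ :=
  if x < L*ρ then
    -(1/ρ) * ∫ y in Iio x, ∫ z in Iio (x + ρ * Real.log (1 - Real.exp ((y-x)/ρ))),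
      Real.exp (-(a/ρ)*z) * K (Real.exp ((y-z)/ρ)) 1 * h y * h z
  else
    -(1/ρ) * (∫ y in Ioi x, Real.exp (-(a/ρ)*y) * h y) * (∫ z in Ioi x, h z)
    + (1/ρ) * (∫ y in Iio x, ∫ z in Ioi x,
        (Real.exp (-(a/ρ)*z) * K (Real.exp ((y-z)/ρ)) 1 - Real.exp (-(a/ρ)*y)) * h y * h z)
    + (1/ρ) * (∫ y in Iio x, ∫ z in Ioo (x + ρ * Real.log (1 - Real.exp ((y-x)/ρ))) x,
        Real.exp (-(a/ρ)*z) * K (Real.exp ((y-z)/ρ)) 1 * h y * h z)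

/-- The remainder R̃[h]. -/
noncomputable def Rtil (K : ℝ → ℝ → ℝ) (a L ρ : ℝ) (h : ℝ → ℝ) (x : ℝ) : ℝ :=
  if x < L*ρ then
    Rfun K a L ρ h x - (1/ρ) * ∫ y in Ioo x (L*ρ),
      Real.exp (-(psiFn K a L ρ h x - psiFn K a L ρ h y)) * Real.exp (-(a/ρ)*y) *
        Qfun K a ρ h y * Rfun K a L ρ h y
  else
    Rfun K a L ρ h x - (1/(1+ρ)) * ∫ y in Ioo (L*ρ) x,
      Real.exp ((y-x)/(1+ρ)) * Rfun K a L ρ h y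

/-- Equation (E) in exponential variables. -/
def solvesE (K : ℝ → ℝ → ℝ) (a ρ : ℝ) (h : ℝ → ℝ) : Prop :=
  ∀ x : ℝ, h x = (1/ρ) * ∫ y in Iio x,
    ∫ z in Ioi (x + ρ * Real.log (1 - Real.exp ((y-x)/ρ))),
      Real.exp (-(a/ρ)*z) * K (Real.exp ((y-z)/ρ)) 1 * h y * h z

/-- The decay exponent λ. -/
noncomputable def lamFn (K : ℝ → ℝ → ℝ) (a L ρ : ℝ) (h : ℝ → ℝ) (x : ℝ) : ℝ :=
  if x < L*ρ then -psiFn K a L ρ h x else -(1/2)*(x - L*ρ)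

/-- The remainder H. -/
noncomputable def Hfun (K : ℝ → ℝ → ℝ) (a ρ : ℝ) (h : ℝ → ℝ) (x : ℝ) : ℝ :=
  (1/ρ) * (∫ y in Iio x, ∫ z in Ioi (x + ρ * Real.log (1 - Real.exp ((y-x)/ρ))),
      Real.exp (-(a/ρ)*z) * K (Real.exp ((y-z)/ρ)) 1 * h y * h z)
    - (ρ/(1+ρ)) * h x - (1/(1+ρ)) * ∫ z in Ioi x, h z


namespace HDecay

noncomputable def Phi (m L t : ℝ) : ℝ := 2 * min 1 (Real.exp (m*(t+L)))

noncomputable def W (K : ℝ → ℝ → ℝ) (a : ℝ) (u v : ℝ) : ℝ :=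
  Real.exp (-a*v) * K (Real.exp (u-v)) 1

def D2 (ξ : ℝ) : Set (ℝ × ℝ) :=
  {p | p.1 < ξ ∧ p.2 < ξ ∧ Real.exp ξ < Real.exp p.1 + Real.exp p.2}

lemma Phi_pos (m L t : ℝ) : 0 < Phi m L t := by
  unfold Phi
  have := Real.exp_pos (m*(t+L))
  positivity

lemma Phi_cont (m L : ℝ) : Continuous (Phi m L) := by
  unfold Phi; fun_prop

lemma W_near {K : ℝ → ℝ → ℝ} {γ a K0 δ : ℝ} (hK : KernelHyp K γ a K0 δ) {u v : ℝ} (h : u ≤ v) :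
    |W K a u v - Real.exp (-a*u)| ≤ K0 * (Real.exp (-a*u) * Real.exp (δ*(u-v))) := by
  obtain ⟨_, _, _, _, _, _, _, _, hb⟩ := hK
  have h1 := hb (Real.exp (u-v)) ⟨Real.exp_pos _, by
    have : Real.exp (u-v) ≤ 1 := Real.exp_le_one_iff.2 (by linarith)
    linarith⟩
  rw [← Real.exp_mul, ← Real.exp_mul] at h1
  have e : W K a u v - Real.exp (-a*u)
      = Real.exp (-a*u) * (Real.exp ((u-v)*a) * K (Real.exp (u-v)) 1 - 1) := by
    unfold W
    rw [mul_sub, ← mul_assoc, ← Real.exp_add]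
    ring_nf
  rw [e, abs_mul, abs_of_pos (Real.exp_pos _), mul_comm δ]
  nlinarith [Real.exp_pos (-a*u)]

lemma W_far {K : ℝ → ℝ → ℝ} {γ a K0 δ : ℝ} (hK : KernelHyp K γ a K0 δ) {u v : ℝ} (h : v ≤ u) :
    |W K a u v - Real.exp (u-(1+a)*v)| ≤ K0 * (Real.exp (u-(1+a)*v) * Real.exp (δ*(v-u))) := by
  obtain ⟨_, ha, _, _, hs, hh, _, _, hb⟩ := hK
  have h1 := hb (Real.exp (v-u)) ⟨Real.exp_pos _, by
    have : Real.exp (v-u) ≤ 1 := Real.exp_le_one_iff.2 (by linarith)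
    linarith⟩
  rw [← Real.exp_mul, ← Real.exp_mul] at h1
  have e0 : K (Real.exp (u-v)) 1 = Real.exp ((u-v)*γ) * K (Real.exp (v-u)) 1 := by
    have := hh 1 (Real.exp (v-u)) (Real.exp (u-v)) one_pos (Real.exp_pos _) (Real.exp_pos _)
    rw [← Real.exp_add, ← Real.exp_mul, hs 1 _ one_pos (Real.exp_pos _)] at this
    simpa using this
  have e : W K a u v - Real.exp (u-(1+a)*v)
      = Real.exp (u-(1+a)*v) * (Real.exp ((v-u)*a) * K (Real.exp (v-u)) 1 - 1) := by
    unfold W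
    rw [e0, mul_sub, ← mul_assoc, ← mul_assoc, ← Real.exp_add, ← Real.exp_add]
    subst ha
    ring_nf
  rw [e, abs_mul, abs_of_pos (Real.exp_pos _), mul_comm δ]
  nlinarith [Real.exp_pos (u-(1+a)*v)]

lemma W_cont {K : ℝ → ℝ → ℝ} {γ a K0 δ : ℝ} (hK : KernelHyp K γ a K0 δ) :
    Continuous (fun p : ℝ × ℝ => W K a p.1 p.2) := by
  obtain ⟨_, _, hc, _⟩ := hK
  unfold W
  refine Continuous.mul (by fun_prop) ?_
  have : Continuous (fun p : ℝ × ℝ => (Real.exp (p.1-p.2), (1:ℝ))) := by fun_prop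
  exact hc.comp_continuous this (fun p => ⟨Real.exp_pos _, by simp⟩)

lemma Phi_int {m L c : ℝ} (hc : 0 < c) (hm : c < m) :
    Integrable (fun t => Real.exp (-c*t) * Phi m L t) := by
  have hcont : Continuous (fun t => Real.exp (-c*t) * Phi m L t) := by
    have := Phi_cont m L
    fun_prop
  rw [← integrableOn_univ, ← Iic_union_Ioi (a := (0:ℝ))]
  refine IntegrableOn.union ?_ ?_
  · have h1 : IntegrableOn (fun t => 2 * Real.exp (m*L) * Real.exp ((m-c)*t)) (Iic (0:ℝ)) :=
      (integrableOn_exp_mul_Iic (by linarith) 0).const_mul _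
    refine h1.mono' hcont.aestronglyMeasurable (ae_of_all _ fun t => ?_)
    rw [Real.norm_eq_abs, abs_of_pos (mul_pos (Real.exp_pos _) (Phi_pos _ _ _))]
    have : Phi m L t ≤ 2 * Real.exp (m*(t+L)) := by
      unfold Phi; gcongr; exact min_le_right _ _
    calc _ ≤ Real.exp (-c*t) * (2 * Real.exp (m*(t+L))) := by gcongr
      _ = 2 * (Real.exp (-c*t) * Real.exp (m*(t+L))) := by ring
      _ = 2 * (Real.exp (m*L) * Real.exp ((m-c)*t)) := by
        rw [← Real.exp_add, ← Real.exp_add]; ring_nf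
      _ = _ := by ring
      _ ≤ _ := le_refl _
  · have h1 : IntegrableOn (fun t => 2 * Real.exp ((-c)*t)) (Ioi (0:ℝ)) :=
      (integrableOn_exp_mul_Ioi (by linarith) 0).const_mul _
    refine h1.mono' hcont.aestronglyMeasurable (ae_of_all _ fun t => ?_)
    rw [Real.norm_eq_abs, abs_of_pos (mul_pos (Real.exp_pos _) (Phi_pos _ _ _))]
    have : Phi m L t ≤ 2 := by
      unfold Phi; have := min_le_left 1 (Real.exp (m*(t+L))); linarith
    nlinarith [Real.exp_pos (-c*t)]

lemma D2_meas (ξ : ℝ) : MeasurableSet (D2 ξ) := by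
  unfold D2
  refine (measurableSet_lt measurable_fst measurable_const).inter
    ((measurableSet_lt measurable_snd measurable_const).inter
      (measurableSet_lt measurable_const (g := fun p : ℝ × ℝ => Real.exp p.1 + Real.exp p.2)
        (by fun_prop)))

lemma slice (ξ v : ℝ) (hv : v < ξ) (c : ℝ) :
    Integrable (fun u => (D2 ξ).indicator (fun p => Real.exp p.1 * c) (u, v)) ∧
    ∫ u, (D2 ξ).indicator (fun p => Real.exp p.1 * c) (u, v) = Real.exp v * c := by
  have hpos : 0 < Real.exp ξ - Real.exp v := by
    have := Real.exp_lt_exp.2 hv; linarith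
  have e : (fun u => (D2 ξ).indicator (fun p => Real.exp p.1 * c) (u, v))
      = (Ioo (Real.log (Real.exp ξ - Real.exp v)) ξ).indicator (fun u => Real.exp u * c) := by
    ext u
    have : (u, v) ∈ D2 ξ ↔ u ∈ Ioo (Real.log (Real.exp ξ - Real.exp v)) ξ := by
      simp only [D2, mem_ofPred_eq, mem_Ioo, Real.log_lt_iff_lt_exp hpos]
      constructor
      · rintro ⟨h1, h2, h3⟩; exact ⟨by linarith, h1⟩
      · rintro ⟨h1, h2⟩; exact ⟨h2, hv, by linarith⟩
    by_cases h : (u, v) ∈ D2 ξ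
    · rw [indicator_of_mem h, indicator_of_mem (this.1 h)]
    · rw [indicator_of_notMem h, indicator_of_notMem (fun h' => h (this.2 h'))]
  have hle : Real.log (Real.exp ξ - Real.exp v) ≤ ξ := by
    rw [Real.log_le_iff_le_exp hpos]; linarith [Real.exp_pos v]
  rw [e]
  constructor
  · rw [integrable_indicator_iff measurableSet_Ioo]
    refine IntegrableOn.mono_set ?_ Ioo_subset_Icc_self
    exact (by fun_prop : Continuous fun u => Real.exp u * c).continuousOn.integrableOn_Icc
  · rw [integral_indicator measurableSet_Ioo, ← integral_Ioc_eq_integral_Ioo,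
      ← intervalIntegral.integral_of_le hle, intervalIntegral.integral_mul_const, integral_exp,
      Real.exp_log hpos]
    ring

lemma D2_int {ξ : ℝ} {f : ℝ → ℝ} (hf : AEStronglyMeasurable f)
    (hi : IntegrableOn (fun t => Real.exp t * f t) (Iio ξ)) :
    IntegrableOn (fun p : ℝ × ℝ => Real.exp p.1 * f p.2) (D2 ξ) ∧
    ∫ p in D2 ξ, Real.exp p.1 * f p.2 = ∫ t in Iio ξ, Real.exp t * f t := by
  have hm : AEStronglyMeasurable
      ((D2 ξ).indicator (fun p : ℝ × ℝ => Real.exp p.1 * f p.2)) (volume.prod volume) := by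
    refine AEStronglyMeasurable.indicator ?_ (D2_meas ξ)
    exact (by fun_prop : Continuous fun p : ℝ × ℝ => Real.exp p.1).aestronglyMeasurable.mul hf.comp_snd
  have key : ∀ v : ℝ, Integrable (fun u => (D2 ξ).indicator (fun p : ℝ × ℝ => Real.exp p.1 * f p.2) (u, v))
      ∧ ∫ u, (D2 ξ).indicator (fun p : ℝ × ℝ => Real.exp p.1 * f p.2) (u, v)
        = (Iio ξ).indicator (fun t => Real.exp t * f t) v
      ∧ ∫ u, ‖(D2 ξ).indicator (fun p : ℝ × ℝ => Real.exp p.1 * f p.2) (u, v)‖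
        = (Iio ξ).indicator (fun t => ‖Real.exp t * f t‖) v := by
    intro v
    by_cases hv : v < ξ
    · have e : (fun u => (D2 ξ).indicator (fun p : ℝ × ℝ => Real.exp p.1 * f p.2) (u, v))
        = (fun u => (D2 ξ).indicator (fun p : ℝ × ℝ => Real.exp p.1 * f v) (u, v)) := by
        ext u; simp only [indicator]
      have e' : (fun u => ‖(D2 ξ).indicator (fun p : ℝ × ℝ => Real.exp p.1 * f p.2) (u, v)‖)
        = (fun u => (D2 ξ).indicator (fun p : ℝ × ℝ => Real.exp p.1 * |f v|) (u, v)) := by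
        ext u; simp only [indicator]; split_ifs <;> simp
      rw [e, e', (slice ξ v hv _).2, (slice ξ v hv _).2, indicator_of_mem (by exact hv),
        indicator_of_mem (by exact hv)]
      exact ⟨(slice ξ v hv _).1, rfl, by simp⟩
    · have e : ∀ u, (u, v) ∉ D2 ξ := fun u h => hv h.2.1
      simp [indicator, e, hv]
  have hint : Integrable ((D2 ξ).indicator (fun p : ℝ × ℝ => Real.exp p.1 * f p.2)) (volume.prod volume) := by
    rw [integrable_prod_iff' hm]
    refine ⟨ae_of_all _ fun v => (key v).1, ?_⟩
    simp_rw [(key _).2.2]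
    rw [integrable_indicator_iff measurableSet_Iio]
    exact hi.norm
  constructor
  · rw [← integrable_indicator_iff (D2_meas ξ)]
    exact hint
  · rw [← integral_indicator (D2_meas ξ), Measure.volume_eq_prod, integral_prod_symm _ hint]
    simp_rw [(key _).2.1]
    rw [integral_indicator measurableSet_Iio]

lemma D2_int' {ξ : ℝ} {f : ℝ → ℝ} (hf : AEStronglyMeasurable f)
    (hi : IntegrableOn (fun t => Real.exp t * f t) (Iio ξ)) :
    IntegrableOn (fun p : ℝ × ℝ => Real.exp p.2 * f p.1) (D2 ξ) ∧
    ∫ p in D2 ξ, Real.exp p.2 * f p.1 = ∫ t in Iio ξ, Real.exp t * f t := by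
  obtain ⟨h1, h2⟩ := D2_int hf hi
  have hs : ∀ p : ℝ × ℝ, p.swap ∈ D2 ξ ↔ p ∈ D2 ξ := by
    intro p; simp only [D2, mem_ofPred_eq, Prod.fst_swap, Prod.snd_swap]
    constructor <;> rintro ⟨h1, h2, h3⟩ <;> exact ⟨h2, h1, by linarith⟩
  have e : (D2 ξ).indicator (fun p : ℝ × ℝ => Real.exp p.2 * f p.1)
      = ((D2 ξ).indicator (fun p : ℝ × ℝ => Real.exp p.1 * f p.2)) ∘ Prod.swap := by
    ext p
    by_cases h : p ∈ D2 ξ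
    · simp [indicator, h, (hs p).2 h]
    · have h' : p.swap ∉ D2 ξ := fun q => h ((hs p).1 q)
      simp [indicator, h, h']
  rw [← integrable_indicator_iff (D2_meas ξ)] at h1 ⊢
  rw [← integral_indicator (D2_meas ξ)] at h2 ⊢
  rw [e]
  constructor
  · exact Integrable.swap h1
  · rw [← h2]
    exact integral_prod_swap (μ := (volume : Measure ℝ)) (ν := (volume : Measure ℝ)) _


set_option maxHeartbeats 2000000 in
lemma rem_bound {K : ℝ → ℝ → ℝ} {γ a K0 δ m L ρ A ξ : ℝ} (hK : KernelHyp K γ a K0 δ)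
    {g : ℝ → ℝ} (hm0 : 0 < m) (hA : 0 < A) (hL : 0 < L) (hρ : 0 < ρ) (hρ2 : ρ < 1/2) (hξ : L ≤ ξ)
    (hg1 : ∀ t, |g t| ≤ Phi m L t) (hg2 : ∀ t, |g t| ≤ 2 * Real.exp (-(ρ/2)*(t-L)))
    (hlip : ∀ τ ∈ Ioo (0:ℝ) 1, |g ξ - g (ξ-τ)| ≤ A * τ * Real.exp (-(ρ/2)*(ξ-L)))
    {u v : ℝ} (hp : (u, v) ∈ D2 ξ) :
    |W K a u v * g u * g v - Real.exp (u-(1+a)*v) * g ξ * g v| ≤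
      (8*K0 + 8*(K0+2) + A * Real.exp 1 + 4 * Real.exp (2+m)) *
        (Real.exp (-(ρ/2)*(ξ-L)) * Real.exp (-δ*ξ)) *
      (Real.exp u * (Real.exp (-(1+a-δ)*v) * Phi m L v)
        + Real.exp v * (Real.exp (-(1+a-δ)*u) * Phi m L u)) := by
  have hKK := hK
  obtain ⟨_, ha, _, _, _, _, hK0, ⟨hδ, hδm⟩, _⟩ := hKK
  have hδ1 : δ < 1 := lt_of_lt_of_le hδm (min_le_left _ _)
  have hδa : δ < a := lt_of_lt_of_le hδm (min_le_right _ _)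
  obtain ⟨hu, hv, hD⟩ := hp
  simp only at hu hv hD
  set E := Real.exp (-(ρ/2)*(ξ-L)) with hE
  have hE0 : 0 < E := Real.exp_pos _
  have hgE : ∀ t ≤ ξ, |g t| ≤ 2 * E * Real.exp (ξ-t) := by
    intro t ht
    refine (hg2 t).trans ?_
    rw [mul_assoc, hE, ← Real.exp_add]
    gcongr
    nlinarith
  have hrs : 1 < Real.exp (v-ξ) + Real.exp (u-ξ) := by
    have e1 : Real.exp (v-ξ) + Real.exp (u-ξ) = (Real.exp u + Real.exp v) / Real.exp ξ := by
      rw [Real.exp_sub, Real.exp_sub]; ring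
    rw [e1, lt_div_iff₀ (Real.exp_pos _)]; linarith
  have hPv := Phi_pos m L v
  have hPu := Phi_pos m L u
  have hle2 : ∀ t, |g t| ≤ 2 := fun t => (hg1 t).trans (by
    unfold Phi; have := min_le_left 1 (Real.exp (m*(t+L))); linarith)
  -- difference bound
  have c1 : |g u - g ξ| * |g v| ≤
      (A * Real.exp 1 + 4 * Real.exp (2+m)) * E * Real.exp (v-ξ) * Phi m L v := by
    have hr0 := Real.exp_pos (v-ξ)
    by_cases h1 : ξ - u < 1
    · have h2 := hlip (ξ-u) ⟨by linarith, h1⟩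
      rw [sub_sub_cancel, abs_sub_comm] at h2
      have h3 : ξ - u ≤ Real.exp 1 * Real.exp (v-ξ) := by
        have q1 := Real.add_one_le_exp (ξ-u)
        have q2 : Real.exp (ξ-u) * Real.exp (u-ξ) = 1 := by rw [← Real.exp_add]; simp
        have q3 : Real.exp (ξ-u) ≤ Real.exp 1 := Real.exp_le_exp.2 h1.le
        have q4 := Real.exp_pos (ξ-u)
        nlinarith
      calc |g u - g ξ| * |g v| ≤ (A * (Real.exp 1 * Real.exp (v-ξ)) * E) * Phi m L v := by
            gcongr
            · exact h2.trans (by gcongr)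
            · exact hg1 v
        _ = (A * Real.exp 1) * E * Real.exp (v-ξ) * Phi m L v := by ring
        _ ≤ _ := by
            gcongr
            have := Real.exp_pos (2+m); linarith
    · push Not at h1
      have q1 : Real.exp (u-ξ) ≤ Real.exp (-1) := Real.exp_le_exp.2 (by linarith)
      have q2 : Real.exp (-1) ≤ 1/2 := by
        have := Real.add_one_le_exp (1:ℝ)
        rw [Real.exp_neg, inv_le_comm₀ (Real.exp_pos _) (by norm_num)]; norm_num; linarith
      have q3 : Real.exp (-1) ≤ Real.exp (v-ξ) := by linarith
      have q4 : -1 ≤ v - ξ := Real.exp_le_exp.1 q3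
      have q5 : 2 * Real.exp (-m) ≤ Phi m L v := by
        unfold Phi; gcongr
        refine le_min (Real.exp_le_one_iff.2 (by linarith)) (Real.exp_le_exp.2 (by nlinarith))
      have q6 : |g v| ≤ 2 * E * Real.exp 1 := (hgE v hv.le).trans (by gcongr; linarith)
      have q7 : |g u - g ξ| ≤ 4 := by
        have := abs_sub (g u) (g ξ)
        linarith [hle2 u, hle2 ξ]
      have e1 : Real.exp (2+m) * Real.exp (-1) * Real.exp (-m) = Real.exp 1 := by
        rw [← Real.exp_add, ← Real.exp_add]; ring_nf
      calc |g u - g ξ| * |g v| ≤ 4 * (2 * E * Real.exp 1) := by gcongr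
        _ = (4 * Real.exp (2+m)) * E * Real.exp (-1) * (2 * Real.exp (-m)) := by
            rw [← e1]; ring
        _ ≤ (4 * Real.exp (2+m)) * E * Real.exp (v-ξ) * Phi m L v := by gcongr
        _ ≤ _ := by
            gcongr
            have := Real.exp_pos 1; nlinarith
  have hrδ : Real.exp (v-ξ) ≤ Real.exp (δ*(v-ξ)) := Real.exp_le_exp.2 (by nlinarith)
  have eX : Real.exp (u-(1+a)*v) * Real.exp (δ*(v-ξ))
      = Real.exp (-δ*ξ) * (Real.exp u * Real.exp (-(1+a-δ)*v)) := by
    rw [← Real.exp_add, ← Real.exp_add, ← Real.exp_add]; ring_nf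
  set X := Real.exp (-δ*ξ) * (Real.exp u * Real.exp (-(1+a-δ)*v)) with hX
  set Y := Real.exp (-δ*ξ) * (Real.exp v * Real.exp (-(1+a-δ)*u)) with hY
  have hX0 : 0 < X := by positivity
  have hY0 : 0 < Y := by positivity
  have P1 : Real.exp (u-(1+a)*v) * (|g u - g ξ| * |g v|) ≤
      (A * Real.exp 1 + 4 * Real.exp (2+m)) * E * (X * Phi m L v) := by
    calc _ ≤ Real.exp (u-(1+a)*v) *
          ((A * Real.exp 1 + 4 * Real.exp (2+m)) * E * Real.exp (δ*(v-ξ)) * Phi m L v) := by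
            refine mul_le_mul_of_nonneg_left (c1.trans ?_) (Real.exp_pos _).le
            gcongr
      _ = (A * Real.exp 1 + 4 * Real.exp (2+m)) * E *
          ((Real.exp (u-(1+a)*v) * Real.exp (δ*(v-ξ))) * Phi m L v) := by ring
      _ = _ := by rw [eX]
  have P2 : |W K a u v - Real.exp (u-(1+a)*v)| * |g u| * |g v| ≤
      8 * K0 * E * (X * Phi m L v) + 8 * (K0+2) * E * (Y * Phi m L u) := by
    rcases le_or_gt v u with h | h
    · have q1 : Real.exp (v-ξ) ≤ Real.exp (u-ξ) := Real.exp_le_exp.2 (by linarith)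
      have q2 : Real.exp (ξ-u) * Real.exp (u-ξ) = 1 := by rw [← Real.exp_add]; simp
      have q3 : Real.exp (ξ-u) ≤ 2 := by nlinarith [Real.exp_pos (ξ-u)]
      have q4 : |g u| ≤ 4 * E := (hgE u hu.le).trans (by
        have := mul_le_mul_of_nonneg_left q3 hE0.le
        linarith)
      have q5 : Real.exp (δ*(v-u)) ≤ 2 * Real.exp (δ*(v-ξ)) := by
        have : Real.exp (δ*(v-u)) = Real.exp (δ*(ξ-u)) * Real.exp (δ*(v-ξ)) := by
          rw [← Real.exp_add]; ring_nf
        rw [this]; gcongr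
        exact (Real.exp_le_exp.2 (by nlinarith)).trans q3
      calc _ ≤ (K0 * (Real.exp (u-(1+a)*v) * (2 * Real.exp (δ*(v-ξ))))) * (4*E) * Phi m L v := by
            gcongr
            · exact (W_far hK h).trans (by gcongr)
            · exact hg1 v
        _ = 8 * K0 * E * ((Real.exp (u-(1+a)*v) * Real.exp (δ*(v-ξ))) * Phi m L v) := by ring
        _ = 8 * K0 * E * (X * Phi m L v) := by rw [eX]
        _ ≤ _ := le_add_of_nonneg_right (by positivity)
    · have q1 : Real.exp (u-ξ) ≤ Real.exp (v-ξ) := Real.exp_le_exp.2 (by linarith)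
      have q2 : Real.exp (ξ-v) * Real.exp (v-ξ) = 1 := by rw [← Real.exp_add]; simp
      have q3 : Real.exp (ξ-v) ≤ 2 := by nlinarith [Real.exp_pos (ξ-v)]
      have q4 : |g v| ≤ 4 * E := (hgE v hv.le).trans (by
        have := mul_le_mul_of_nonneg_left q3 hE0.le
        linarith)
      have q5 : |W K a u v - Real.exp (u-(1+a)*v)| ≤ (K0+2) * Real.exp (-a*u) := by
        have w1 := W_near hK h.le
        have w2 : Real.exp (δ*(u-v)) ≤ 1 := Real.exp_le_one_iff.2 (by nlinarith)
        have w3 : Real.exp (u-(1+a)*v) ≤ Real.exp (-a*u) := Real.exp_le_exp.2 (by nlinarith)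
        have w4 : K0 * (Real.exp (-a*u) * Real.exp (δ*(u-v))) ≤ K0 * (Real.exp (-a*u) * 1) := by
          gcongr
        have w5 := Real.exp_pos (-a*u)
        have w6 := Real.exp_pos (u-(1+a)*v)
        rw [abs_le] at w1 ⊢
        constructor <;> nlinarith
      have q6 : Real.exp (-a*u) ≤ 2 * Y := by
        have e1 : Y = Real.exp (-a*u) * Real.exp (v-ξ) * Real.exp ((1-δ)*(ξ-u)) := by
          rw [hY, ← Real.exp_add, ← Real.exp_add, ← Real.exp_add, ← Real.exp_add]; ring_nf
        have e2 : 1 ≤ Real.exp ((1-δ)*(ξ-u)) := Real.one_le_exp (by nlinarith)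
        have e3 : 1/2 ≤ Real.exp (v-ξ) := by linarith
        have : Real.exp (-a*u) * (1/2) * 1 ≤ Y := by rw [e1]; gcongr
        linarith
      calc _ ≤ ((K0+2) * (2 * Y)) * Phi m L u * (4*E) := by
            gcongr
            · exact q5.trans (by gcongr)
            · exact hg1 u
        _ = 8 * (K0+2) * E * (Y * Phi m L u) := by ring
        _ ≤ _ := le_add_of_nonneg_left (by positivity)
  have e0 : W K a u v * g u * g v - Real.exp (u-(1+a)*v) * g ξ * g v
      = (W K a u v - Real.exp (u-(1+a)*v)) * g u * g v
        + Real.exp (u-(1+a)*v) * ((g u - g ξ) * g v) := by ring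
  rw [e0]
  refine (abs_add_le _ _).trans ?_
  rw [abs_mul, abs_mul, abs_mul (Real.exp _), abs_mul (g u - g ξ), abs_of_pos (Real.exp_pos _)]
  refine (add_le_add P2 P1).trans ?_
  have t1 : 0 < E * (X * Phi m L v) := by positivity
  have t2 : 0 < E * (Y * Phi m L u) := by positivity
  have t3 : 0 < A * Real.exp 1 + 4 * Real.exp (2+m) := by positivity
  have eR : (8*K0 + 8*(K0+2) + A * Real.exp 1 + 4 * Real.exp (2+m)) *
        (E * Real.exp (-δ*ξ)) *
      (Real.exp u * (Real.exp (-(1+a-δ)*v) * Phi m L v)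
        + Real.exp v * (Real.exp (-(1+a-δ)*u) * Phi m L u))
      = (8*K0 + 8*(K0+2) + (A * Real.exp 1 + 4 * Real.exp (2+m))) * (E * (X * Phi m L v))
        + (8*K0 + 8*(K0+2) + (A * Real.exp 1 + 4 * Real.exp (2+m))) * (E * (Y * Phi m L u)) := by
    rw [hX, hY]; ring
  rw [eR]
  nlinarith [mul_pos hK0 t1, mul_pos hK0 t2, mul_pos t3 t1, mul_pos t3 t2]


lemma exp_Ici {c ξ : ℝ} (hc : 0 < c) :
    IntegrableOn (fun t => Real.exp (-c*t)) (Ici ξ) ∧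
    ∫ t in Ici ξ, Real.exp (-c*t) = Real.exp (-c*ξ) / c := by
  constructor
  · rw [integrableOn_Ici_iff_integrableOn_Ioi]
    exact integrableOn_exp_mul_Ioi (by linarith) _
  · rw [integral_Ici_eq_integral_Ioi, integral_exp_mul_Ioi (by linarith)]
    field_simp

set_option maxHeartbeats 2000000 in
lemma core {K : ℝ → ℝ → ℝ} {γ a K0 δ m L ρ A ξ : ℝ} (hK : KernelHyp K γ a K0 δ)
    {g : ℝ → ℝ} (hgm : AEStronglyMeasurable g) (hm : a + 1 < m) (hA : 0 < A) (hL : 0 < L)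
    (hρ : 0 < ρ) (hρ2 : ρ < 1/2) (hρδ : ρ < δ) (hρa : ρ < a/2) (hξ : L ≤ ξ)
    (hmom : ∫ t, Real.exp (-a*t) * g t = 1/(1+ρ))
    (hg1 : ∀ t, |g t| ≤ Phi m L t) (hg2 : ∀ t, |g t| ≤ 2 * Real.exp (-(ρ/2)*(t-L)))
    (hlip : ∀ τ ∈ Ioo (0:ℝ) 1, |g ξ - g (ξ-τ)| ≤ A * τ * Real.exp (-(ρ/2)*(ξ-L))) :
    IntegrableOn (fun p : ℝ × ℝ => W K a p.1 p.2 * g p.1 * g p.2) (Iio ξ ×ˢ Ici ξ ∪ D2 ξ) ∧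
    |ρ * (∫ p in Iio ξ ×ˢ Ici ξ ∪ D2 ξ, W K a p.1 p.2 * g p.1 * g p.2)
      - ρ/(1+ρ) * g ξ - 1/(1+ρ) * (ρ * ∫ t in Ici ξ, g t)| ≤
    ((2*K0*(∫ t, Real.exp (-(a-δ)*t) * Phi m L t)/δ + 4/a
      + 2 * (8*K0 + 8*(K0+2) + A * Real.exp 1 + 4 * Real.exp (2+m)) *
        (∫ t, Real.exp (-(a-δ)*t) * Phi m L t)) * ρ + 8/a * Real.exp (-a*L))
      * Real.exp (-(3/2)*(ρ*(ξ-L))) := by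
  have hKK := hK
  obtain ⟨_, _, _, _, _, _, hK0, ⟨hδ, hδm⟩, _⟩ := hKK
  have hδ1 : δ < 1 := lt_of_lt_of_le hδm (min_le_left _ _)
  have hδa : δ < a := lt_of_lt_of_le hδm (min_le_right _ _)
  have ha : 0 < a := by linarith
  set B := 8*K0 + 8*(K0+2) + A * Real.exp 1 + 4 * Real.exp (2+m) with hB
  have hB0 : 0 < B := by positivity
  set M := ∫ t, Real.exp (-(a-δ)*t) * Phi m L t with hM
  set E := Real.exp (-(ρ/2)*(ξ-L)) with hE
  have hE0 : 0 < E := Real.exp_pos _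
  have hMi : Integrable (fun t => Real.exp (-(a-δ)*t) * Phi m L t) :=
    Phi_int (by linarith) (by linarith)
  have hMn : ∀ t, 0 ≤ Real.exp (-(a-δ)*t) * Phi m L t := fun t =>
    mul_nonneg (Real.exp_pos _).le (Phi_pos _ _ _).le
  have hM0 : 0 ≤ M := integral_nonneg hMn
  have hMs : ∀ s : Set ℝ, ∫ t in s, Real.exp (-(a-δ)*t) * Phi m L t ≤ M := fun s =>
    setIntegral_le_integral hMi (ae_of_all _ hMn)
  have hPc := Phi_cont m L
  have hgE : ∀ t ∈ Ici ξ, |g t| ≤ 2 * E := by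
    intro t ht
    refine (hg2 t).trans ?_
    have : ξ ≤ t := ht
    rw [hE]; gcongr 2 * Real.exp ?_; nlinarith
  -- moment integrability
  have hag : Integrable (fun t => Real.exp (-a*t) * g t) := by
    refine (Phi_int (m := m) (L := L) ha (by linarith)).mono'
      ((by fun_prop : Continuous fun t => Real.exp (-a*t)).aestronglyMeasurable.mul hgm)
      (ae_of_all _ fun t => ?_)
    rw [norm_mul, Real.norm_eq_abs, Real.norm_eq_abs, abs_of_pos (Real.exp_pos _)]
    gcongr; exact hg1 t
  have hgI0 : IntegrableOn (fun t => 2 * Real.exp (ρ/2*L) * Real.exp (-(ρ/2)*t)) (Ici ξ) :=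
    (exp_Ici (by linarith)).1.const_mul _
  have hgb : ∀ t, ‖g t‖ ≤ 2 * Real.exp (ρ/2*L) * Real.exp (-(ρ/2)*t) := by
    intro t
    refine (hg2 t).trans (le_of_eq ?_)
    rw [mul_assoc, ← Real.exp_add]; ring_nf
  have hgI : IntegrableOn g (Ici ξ) := hgI0.mono' hgm.restrict (ae_of_all _ hgb)
  set S := ∫ t in Ici ξ, g t with hS
  set T := ∫ t in Ici ξ, Real.exp (-a*t) * g t with hT
  have hSb : |S| ≤ 4/ρ * E := by
    refine (norm_integral_le_of_norm_le hgI0 (ae_of_all _ hgb)).trans (le_of_eq ?_)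
    rw [integral_const_mul, (exp_Ici (by linarith)).2, hE]
    have : Real.exp (-(ρ/2)*(ξ-L)) = Real.exp (ρ/2*L) * Real.exp (-(ρ/2)*ξ) := by
      rw [← Real.exp_add]; ring_nf
    rw [this]; field_simp; ring
  have hTb : |T| ≤ 2 * E * (Real.exp (-a*ξ)/a) := by
    have h1 : IntegrableOn (fun t => 2 * E * Real.exp (-a*t)) (Ici ξ) := (exp_Ici ha).1.const_mul _
    have h2 : ∀ᵐ t ∂(volume.restrict (Ici ξ)),
        ‖Real.exp (-a*t) * g t‖ ≤ 2 * E * Real.exp (-a*t) := by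
      refine (ae_restrict_iff' measurableSet_Ici).2 (ae_of_all _ fun t ht => ?_)
      rw [norm_mul, Real.norm_eq_abs, Real.norm_eq_abs, abs_of_pos (Real.exp_pos _), mul_comm]
      gcongr; exact hgE t ht
    refine (norm_integral_le_of_norm_le h1 h2).trans (le_of_eq ?_)
    rw [integral_const_mul, (exp_Ici ha).2]
  have hTc : ∫ t in Iio ξ, Real.exp (-a*t) * g t = 1/(1+ρ) - T := by
    have := integral_add_compl (μ := volume) (measurableSet_Ici (a := ξ)) hag
    rw [compl_Ici, hmom] at this
    linarith
  have hWm : AEStronglyMeasurable (fun p : ℝ × ℝ => W K a p.1 p.2) := (W_cont hK).aestronglyMeasurable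
  have hgm1 : AEStronglyMeasurable (fun p : ℝ × ℝ => g p.1) := hgm.comp_fst
  have hgm2 : AEStronglyMeasurable (fun p : ℝ × ℝ => g p.2) := hgm.comp_snd
  have hFm : AEStronglyMeasurable (fun p : ℝ × ℝ => W K a p.1 p.2 * g p.1 * g p.2) :=
    (hWm.mul hgm1).mul hgm2
  have hD1m : MeasurableSet (Iio ξ ×ˢ Ici ξ : Set (ℝ × ℝ)) := measurableSet_Iio.prod measurableSet_Ici
  -- D1
  have i1 : IntegrableOn (fun p : ℝ × ℝ => (Real.exp (-a*p.1) * g p.1) * g p.2) (Iio ξ ×ˢ Ici ξ) := by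
    rw [IntegrableOn, Measure.volume_eq_prod, ← Measure.prod_restrict]
    exact hag.restrict.mul_prod hgI
  have v1 : ∫ p in Iio ξ ×ˢ Ici ξ, (Real.exp (-a*p.1) * g p.1) * g p.2 = (1/(1+ρ) - T) * S := by
    rw [Measure.volume_eq_prod, setIntegral_prod_mul (fun t => Real.exp (-a*t) * g t) g, hTc]
  have i2' : IntegrableOn (fun p : ℝ × ℝ => (2*K0*E) *
      ((Real.exp (-(a-δ)*p.1) * Phi m L p.1) * Real.exp (-δ*p.2))) (Iio ξ ×ˢ Ici ξ) := by
    rw [IntegrableOn, Measure.volume_eq_prod, ← Measure.prod_restrict]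
    exact (hMi.restrict.mul_prod (exp_Ici hδ).1).const_mul _
  have b2 : ∀ p ∈ (Iio ξ ×ˢ Ici ξ : Set (ℝ × ℝ)),
      ‖W K a p.1 p.2 * g p.1 * g p.2 - (Real.exp (-a*p.1) * g p.1) * g p.2‖ ≤
      (2*K0*E) * ((Real.exp (-(a-δ)*p.1) * Phi m L p.1) * Real.exp (-δ*p.2)) := by
    rintro ⟨u, v⟩ ⟨hu, hv⟩
    have hu' : u < ξ := hu
    have hv' : ξ ≤ v := hv
    have e : W K a u v * g u * g v - (Real.exp (-a*u) * g u) * g v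
      = (W K a u v - Real.exp (-a*u)) * g u * g v := by ring
    simp only
    rw [e, norm_mul, norm_mul]
    have w := W_near hK (u := u) (v := v) (by linarith)
    calc _ ≤ K0 * (Real.exp (-a*u) * Real.exp (δ*(u-v))) * Phi m L u * (2*E) := by
          have := Phi_pos m L u
          have := hg1 u
          have := hgE v hv
          gcongr <;> assumption
      _ = (2*K0*E) * ((Real.exp (-a*u) * Real.exp (δ*(u-v))) * Phi m L u) := by ring
      _ = (2*K0*E) * ((Real.exp (-(a-δ)*u) * Real.exp (-δ*v)) * Phi m L u) := by
          rw [← Real.exp_add, ← Real.exp_add]; ring_nf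
      _ = _ := by ring
  have i2 : IntegrableOn (fun p : ℝ × ℝ => W K a p.1 p.2 * g p.1 * g p.2
      - (Real.exp (-a*p.1) * g p.1) * g p.2) (Iio ξ ×ˢ Ici ξ) := by
    refine i2'.mono' (hFm.restrict.sub i1.aestronglyMeasurable) ?_
    exact (ae_restrict_iff' hD1m).2 (ae_of_all _ b2)
  have v2 : |∫ p in Iio ξ ×ˢ Ici ξ, (W K a p.1 p.2 * g p.1 * g p.2
      - (Real.exp (-a*p.1) * g p.1) * g p.2)| ≤ (2*K0*E) * (M * (Real.exp (-δ*ξ)/δ)) := by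
    refine (norm_integral_le_of_norm_le i2' ((ae_restrict_iff' hD1m).2 (ae_of_all _ b2))).trans ?_
    rw [integral_const_mul, Measure.volume_eq_prod, setIntegral_prod_mul
      (fun t => Real.exp (-(a-δ)*t) * Phi m L t) (fun t => Real.exp (-δ*t)), (exp_Ici hδ).2]
    gcongr
    exact hMs _
  have iD1 : IntegrableOn (fun p : ℝ × ℝ => W K a p.1 p.2 * g p.1 * g p.2) (Iio ξ ×ˢ Ici ξ) := by
    refine (i2.add i1).congr (ae_of_all _ fun p => ?_)
    simp
  have vD1 : ∫ p in Iio ξ ×ˢ Ici ξ, W K a p.1 p.2 * g p.1 * g p.2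
      = (∫ p in Iio ξ ×ˢ Ici ξ, (W K a p.1 p.2 * g p.1 * g p.2
      - (Real.exp (-a*p.1) * g p.1) * g p.2)) + (1/(1+ρ) - T) * S := by
    rw [integral_sub iD1 i1, v1]; ring
  -- D2
  have f1 : AEStronglyMeasurable (fun t => g ξ * (Real.exp (-(1+a)*t) * g t)) :=
    ((by fun_prop : Continuous fun t => Real.exp (-(1+a)*t)).aestronglyMeasurable.mul hgm).const_mul _
  have f1e : (fun t => Real.exp t * (g ξ * (Real.exp (-(1+a)*t) * g t)))
      = fun t => g ξ * (Real.exp (-a*t) * g t) := by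
    ext t
    have : Real.exp (-a*t) = Real.exp t * Real.exp (-(1+a)*t) := by
      rw [← Real.exp_add]; ring_nf
    rw [this]; ring
  obtain ⟨j1', w1'⟩ := D2_int (ξ := ξ) f1 (by rw [f1e]; exact (hag.const_mul _).integrableOn)
  rw [f1e, integral_const_mul, hTc] at w1'
  have f1f : (fun p : ℝ × ℝ => Real.exp p.1 * (g ξ * (Real.exp (-(1+a)*p.2) * g p.2)))
      = fun p => Real.exp (p.1-(1+a)*p.2) * g ξ * g p.2 := by
    ext p
    have : Real.exp (p.1-(1+a)*p.2) = Real.exp p.1 * Real.exp (-(1+a)*p.2) := by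
      rw [← Real.exp_add]; ring_nf
    rw [this]; ring
  rw [f1f] at j1' w1'
  have f2 : AEStronglyMeasurable (fun t => Real.exp (-(1+a-δ)*t) * Phi m L t) :=
    (by fun_prop : Continuous fun t => Real.exp (-(1+a-δ)*t) * Phi m L t).aestronglyMeasurable
  have f2e : (fun t => Real.exp t * (Real.exp (-(1+a-δ)*t) * Phi m L t))
      = fun t => Real.exp (-(a-δ)*t) * Phi m L t := by
    ext t
    rw [← mul_assoc, ← Real.exp_add]; ring_nf
  obtain ⟨j2, w2⟩ := D2_int (ξ := ξ) f2 (by rw [f2e]; exact hMi.integrableOn)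
  obtain ⟨j3, w3⟩ := D2_int' (ξ := ξ) f2 (by rw [f2e]; exact hMi.integrableOn)
  rw [f2e] at w2 w3
  have j4 := (j2.add j3).const_mul (B * (E * Real.exp (-δ*ξ)))
  have b4 : ∀ p ∈ D2 ξ,
      ‖W K a p.1 p.2 * g p.1 * g p.2 - Real.exp (p.1-(1+a)*p.2) * g ξ * g p.2‖ ≤
      B * (E * Real.exp (-δ*ξ)) *
      ((fun p : ℝ × ℝ => Real.exp p.1 * (Real.exp (-(1+a-δ)*p.2) * Phi m L p.2))
        + (fun p : ℝ × ℝ => Real.exp p.2 * (Real.exp (-(1+a-δ)*p.1) * Phi m L p.1))) p := by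
    rintro ⟨u, v⟩ hp
    exact rem_bound hK (by linarith) hA hL hρ hρ2 hξ hg1 hg2 hlip hp
  have i4 : IntegrableOn (fun p : ℝ × ℝ => W K a p.1 p.2 * g p.1 * g p.2
      - Real.exp (p.1-(1+a)*p.2) * g ξ * g p.2) (D2 ξ) := by
    refine j4.mono' (hFm.restrict.sub j1'.aestronglyMeasurable) ?_
    exact (ae_restrict_iff' (D2_meas ξ)).2 (ae_of_all _ b4)
  have v4 : |∫ p in D2 ξ, (W K a p.1 p.2 * g p.1 * g p.2
      - Real.exp (p.1-(1+a)*p.2) * g ξ * g p.2)| ≤ B * (E * Real.exp (-δ*ξ)) * (M + M) := by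
    refine (norm_integral_le_of_norm_le j4 ((ae_restrict_iff' (D2_meas ξ)).2 (ae_of_all _ b4))).trans ?_
    rw [integral_const_mul]
    simp only [Pi.add_apply]
    rw [integral_add j2 j3, w2, w3]
    have := hMs (Iio ξ)
    gcongr
  have iD2 : IntegrableOn (fun p : ℝ × ℝ => W K a p.1 p.2 * g p.1 * g p.2) (D2 ξ) := by
    refine (i4.add j1').congr (ae_of_all _ fun p => ?_)
    simp
  have vD2 : ∫ p in D2 ξ, W K a p.1 p.2 * g p.1 * g p.2
      = (∫ p in D2 ξ, (W K a p.1 p.2 * g p.1 * g p.2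
      - Real.exp (p.1-(1+a)*p.2) * g ξ * g p.2)) + g ξ * (1/(1+ρ) - T) := by
    rw [integral_sub iD2 j1', w1']; ring
  refine ⟨iD1.union iD2, ?_⟩
  have hdisj : Disjoint (Iio ξ ×ˢ Ici ξ : Set (ℝ × ℝ)) (D2 ξ) := by
    rw [Set.disjoint_left]
    rintro ⟨u, v⟩ ⟨_, h1⟩ ⟨_, h2, _⟩
    exact absurd h2 (not_lt.2 h1)
  rw [setIntegral_union hdisj (D2_meas ξ) iD1 iD2, vD1, vD2]
  set I1 := ∫ p in Iio ξ ×ˢ Ici ξ, (W K a p.1 p.2 * g p.1 * g p.2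
      - (Real.exp (-a*p.1) * g p.1) * g p.2)
  set I2 := ∫ p in D2 ξ, (W K a p.1 p.2 * g p.1 * g p.2
      - Real.exp (p.1-(1+a)*p.2) * g ξ * g p.2)
  have e : ρ * (I1 + (1/(1+ρ) - T) * S + (I2 + g ξ * (1/(1+ρ) - T)))
      - ρ/(1+ρ) * g ξ - 1/(1+ρ) * (ρ * S) = ρ * I1 - ρ * (T * S) + ρ * I2 - ρ * (g ξ * T) := by
    field_simp; ring
  rw [e]
  have hE3 : Real.exp (-(3/2)*(ρ*(ξ-L))) = E * E * E := by
    rw [hE, ← Real.exp_add, ← Real.exp_add]; ring_nf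
  have hδE : Real.exp (-δ*ξ) ≤ E * E := by
    rw [hE, ← Real.exp_add]; apply Real.exp_le_exp.2; nlinarith
  have haE : Real.exp (-a*ξ) ≤ Real.exp (-a*L) * E := by
    rw [hE, ← Real.exp_add]; apply Real.exp_le_exp.2; nlinarith
  have haL : Real.exp (-a*L) ≤ 1 := Real.exp_le_one_iff.2 (by nlinarith)
  have k1 : |ρ * I1| ≤ ρ * (2*K0*M/δ) * (E*E*E) := by
    rw [abs_mul, abs_of_pos hρ]
    calc _ ≤ ρ * ((2*K0*E) * (M * ((E*E)/δ))) := by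
          gcongr; exact v2.trans (by gcongr)
      _ = _ := by ring
  have k2 : |ρ * (T * S)| ≤ 8/a * Real.exp (-a*L) * (E*E*E) := by
    rw [abs_mul, abs_of_pos hρ, abs_mul]
    calc _ ≤ ρ * ((2 * E * ((Real.exp (-a*L) * E)/a)) * (4/ρ * E)) := by
          gcongr; exact hTb.trans (by gcongr)
      _ = _ := by field_simp; ring
  have k3 : |ρ * I2| ≤ ρ * (2 * B * M) * (E*E*E) := by
    rw [abs_mul, abs_of_pos hρ]
    calc _ ≤ ρ * (B * (E * (E*E)) * (M + M)) := by
          gcongr; exact v4.trans (by gcongr)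
      _ = _ := by ring
  have k4 : |ρ * (g ξ * T)| ≤ ρ * (4/a) * (E*E*E) := by
    rw [abs_mul, abs_of_pos hρ, abs_mul]
    calc _ ≤ ρ * ((2 * E) * (2 * E * ((1 * E)/a))) := by
          gcongr
          · exact hgE ξ self_mem_Ici
          · refine hTb.trans ?_
            gcongr
            exact haE.trans (by gcongr)
      _ = _ := by ring
  rw [hE3]
  have t1 := abs_sub (ρ * I1 - ρ * (T * S) + ρ * I2) (ρ * (g ξ * T))
  have t2 := abs_add_le (ρ * I1 - ρ * (T * S)) (ρ * I2)
  have t3 := abs_sub (ρ * I1) (ρ * (T * S))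
  linarith


lemma mem_D (ξ u v : ℝ) : (u, v) ∈ (Iio ξ ×ˢ Ici ξ ∪ D2 ξ : Set (ℝ × ℝ)) ↔
    u < ξ ∧ Real.exp ξ < Real.exp u + Real.exp v := by
  simp only [mem_union, mem_prod, mem_Iio, mem_Ici, D2, mem_ofPred_eq]
  constructor
  · rintro (⟨h1, h2⟩ | ⟨h1, _, h3⟩)
    · refine ⟨h1, ?_⟩
      have := Real.exp_le_exp.2 h2
      linarith [Real.exp_pos u]
    · exact ⟨h1, h3⟩
  · rintro ⟨h1, h2⟩
    rcases le_or_gt ξ v with h | h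
    · exact Or.inl ⟨h1, h⟩
    · exact Or.inr ⟨h1, h, h2⟩

lemma link (K : ℝ → ℝ → ℝ) (a ρ : ℝ) (h : ℝ → ℝ) (x : ℝ) (hρ : 0 < ρ)
    (hi : IntegrableOn (fun p : ℝ × ℝ => W K a p.1 p.2 * h (ρ*p.1) * h (ρ*p.2))
      (Iio (x/ρ) ×ˢ Ici (x/ρ) ∪ D2 (x/ρ))) :
    Hfun K a ρ h x = ρ * (∫ p in Iio (x/ρ) ×ˢ Ici (x/ρ) ∪ D2 (x/ρ),
        W K a p.1 p.2 * h (ρ*p.1) * h (ρ*p.2))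
      - ρ/(1+ρ) * h x - 1/(1+ρ) * (ρ * ∫ t in Ici (x/ρ), h (ρ*t)) := by
  set ξ := x/ρ with hξ
  have hDm : MeasurableSet (Iio ξ ×ˢ Ici ξ ∪ D2 ξ : Set (ℝ × ℝ)) :=
    (measurableSet_Iio.prod measurableSet_Ici).union (D2_meas ξ)
  set Gd : ℝ × ℝ → ℝ := (Iio ξ ×ˢ Ici ξ ∪ D2 ξ : Set (ℝ × ℝ)).indicator
    (fun p : ℝ × ℝ => W K a p.1 p.2 * h (ρ*p.1) * h (ρ*p.2)) with hGd
  have key : ∀ y : ℝ, (Iio x).indicator (fun y => ∫ z in Ioi (x + ρ * Real.log (1 - Real.exp ((y-x)/ρ))),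
      Real.exp (-(a/ρ)*z) * K (Real.exp ((y-z)/ρ)) 1 * h y * h z) y = ρ * ∫ v, Gd (y/ρ, v) := by
    intro y
    have e1 : ρ * ∫ v, Gd (y/ρ, v) = ∫ z, Gd (y/ρ, z/ρ) := by
      rw [Measure.integral_comp_div (fun v => Gd (y/ρ, v)) ρ, abs_of_pos hρ, smul_eq_mul]
    rw [e1]
    by_cases hy : y < x
    · rw [indicator_of_mem (by exact hy), ← integral_indicator measurableSet_Ioi]
      congr 1
      ext z
      have hu : y/ρ < ξ := by rw [hξ]; gcongr
      have hpos : 0 < 1 - Real.exp ((y-x)/ρ) := by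
        have : Real.exp ((y-x)/ρ) < 1 := by
          rw [← Real.exp_zero]
          exact Real.exp_lt_exp.2 (div_neg_of_neg_of_pos (by linarith) hρ)
        linarith
      have hmem : z ∈ Ioi (x + ρ * Real.log (1 - Real.exp ((y-x)/ρ))) ↔
          (y/ρ, z/ρ) ∈ (Iio ξ ×ˢ Ici ξ ∪ D2 ξ : Set (ℝ × ℝ)) := by
        rw [mem_D, mem_Ioi]
        have s1 : x + ρ * Real.log (1 - Real.exp ((y-x)/ρ)) < z ↔
            Real.log (1 - Real.exp ((y-x)/ρ)) < (z-x)/ρ := by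
          rw [lt_div_iff₀ hρ]; constructor <;> intro q <;> linarith
        rw [s1, Real.log_lt_iff_lt_exp hpos, sub_div, sub_div, Real.exp_sub, Real.exp_sub, ← hξ]
        have s2 := Real.exp_pos ξ
        rw [one_sub_div s2.ne', div_lt_div_iff_of_pos_right s2]
        constructor
        · intro q; exact ⟨hu, by linarith⟩
        · rintro ⟨_, q⟩; linarith
      rw [hGd]
      by_cases hz : z ∈ Ioi (x + ρ * Real.log (1 - Real.exp ((y-x)/ρ)))
      · rw [indicator_of_mem hz, indicator_of_mem (hmem.1 hz)]
        simp only [W]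
        rw [mul_div_cancel₀ _ hρ.ne', mul_div_cancel₀ _ hρ.ne', ← sub_div]
        congr 4
        ring
      · rw [indicator_of_notMem hz, indicator_of_notMem (fun q => hz (hmem.2 q))]
    · rw [indicator_of_notMem (by exact hy)]
      have : ∀ z, Gd (y/ρ, z/ρ) = 0 := by
        intro z
        rw [hGd, indicator_of_notMem]
        rw [mem_D]
        rintro ⟨q, _⟩
        rw [hξ, div_lt_div_iff_of_pos_right hρ] at q
        exact hy q
      simp [this]
  have e2 : (∫ y in Iio x, ∫ z in Ioi (x + ρ * Real.log (1 - Real.exp ((y-x)/ρ))),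
      Real.exp (-(a/ρ)*z) * K (Real.exp ((y-z)/ρ)) 1 * h y * h z)
      = ρ * (ρ * ∫ p in Iio ξ ×ˢ Ici ξ ∪ D2 ξ, W K a p.1 p.2 * h (ρ*p.1) * h (ρ*p.2)) := by
    rw [← integral_indicator measurableSet_Iio]
    simp_rw [key]
    rw [integral_const_mul, Measure.integral_comp_div (fun u => ∫ v, Gd (u, v)) ρ, abs_of_pos hρ,
      smul_eq_mul, ← integral_indicator hDm, Measure.volume_eq_prod, integral_prod]
    rw [← integrable_indicator_iff hDm] at hi
    exact hi
  have e3 : (∫ z in Ioi x, h z) = ρ * ∫ t in Ici ξ, h (ρ*t) := by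
    rw [← integral_Ici_eq_integral_Ioi, ← integral_indicator measurableSet_Ici,
      ← integral_indicator measurableSet_Ici]
    have := Measure.integral_comp_div ((Ici ξ).indicator fun t => h (ρ*t)) ρ
    rw [abs_of_pos hρ, smul_eq_mul] at this
    rw [← this]
    congr 1
    ext z
    have : z ∈ Ici x ↔ z/ρ ∈ Ici ξ := by
      rw [mem_Ici, mem_Ici, hξ, div_le_div_iff_of_pos_right hρ]
    by_cases hz : z ∈ Ici x
    · rw [indicator_of_mem hz, indicator_of_mem (this.1 hz), mul_div_cancel₀ _ hρ.ne']
    · rw [indicator_of_notMem hz, indicator_of_notMem (fun q => hz (this.2 q))]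
  unfold Hfun
  rw [e2, e3]
  field_simp

end HDecay

/-- decay of the remainder H (Lemma 6.2 of the paper). -/
theorem H_decay
    (K : ℝ → ℝ → ℝ) (γ a K0 δ m L0 ρ0 : ℝ)
    (hK : KernelHyp K γ a K0 δ) (hP : ParamHyp a m L0 ρ0) :
    ∃ C : ℝ, 0 < C ∧
      ∀ L : ℝ, L0 ≤ L → ∀ A : ℝ, 0 < A → ∃ CL : ℝ, 0 < CL ∧
      ∀ ρ ∈ Ioo (0:ℝ) ρ0, ρ < min δ (min (a/2) (1/2)) →
      ∀ h : ℝ → ℝ, memX a m L ρ h →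
      (∀ y : ℝ, y < L*ρ → Qfun K a ρ h y ∈ Icc (1/2:ℝ) (3/2)) →
      (∀ x : ℝ, |h x| ≤ 2 * Real.exp (lamFn K a L ρ h x)) →
      (∀ x : ℝ, L*ρ ≤ x → ∀ τ ∈ Ioo (0:ℝ) ρ,
        |(h x - h (x - τ))/τ| ≤ (A/ρ) * Real.exp (-(1/2)*(x - L*ρ))) →
      ∀ x : ℝ, L*ρ ≤ x →
        |Hfun K a ρ h x| ≤ (CL * ρ + C * Real.exp (-a*L)) * Real.exp (-(3/2)*(x - L*ρ)) := by
  have hKK := hK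
  obtain ⟨_, _, _, _, _, _, hK0, ⟨hδ, hδm⟩, _⟩ := hKK
  have hδa : δ < a := lt_of_lt_of_le hδm (min_le_right _ _)
  have ha : 0 < a := by linarith
  obtain ⟨hm, hL0, _⟩ := hP
  have hm1 : a + 1 < m := lt_of_le_of_lt (le_max_left _ _) hm
  refine ⟨8/a, by positivity, fun L hL A hA => ?_⟩
  have hLpos : 0 < L := by
    have h1 : 0 < Real.log (4*m) := Real.log_pos (by linarith)
    have : 0 < (1/a) * Real.log (4*m) := by positivity
    linarith
  have hM0 : 0 ≤ ∫ t, Real.exp (-(a-δ)*t) * HDecay.Phi m L t := integral_nonneg fun t =>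
    mul_nonneg (Real.exp_pos _).le (HDecay.Phi_pos _ _ _).le
  refine ⟨2*K0*(∫ t, Real.exp (-(a-δ)*t) * HDecay.Phi m L t)/δ + 4/a
      + 2 * (8*K0 + 8*(K0+2) + A * Real.exp 1 + 4 * Real.exp (2+m)) *
        (∫ t, Real.exp (-(a-δ)*t) * HDecay.Phi m L t), by positivity, ?_⟩
  rintro ρ ⟨hρ, _⟩ hρmin h ⟨hc, _, hmom, hb⟩ _ _ hlip x hx
  have hρδ : ρ < δ := lt_of_lt_of_le hρmin (min_le_left _ _)
  have hρa : ρ < a/2 := lt_of_lt_of_le hρmin ((min_le_right _ _).trans (min_le_left _ _))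
  have hρ2 : ρ < 1/2 := lt_of_lt_of_le hρmin ((min_le_right _ _).trans (min_le_right _ _))
  have hgm : AEStronglyMeasurable (fun t => h (ρ*t)) := by
    have hcg : ContinuousOn (fun t => h (ρ*t)) ({L}ᶜ : Set ℝ) := by
      refine hc.comp (by fun_prop) ?_
      intro t ht q
      apply ht
      have : ρ * t = L * ρ := q
      rw [mul_comm L] at this
      exact mul_left_cancel₀ hρ.ne' this
    have := hcg.aestronglyMeasurable (μ := volume) (measurableSet_singleton L).compl
    rwa [Measure.restrict_eq_self_of_ae_mem] at this
    rw [ae_iff]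
    simp
  have hmom' : ∫ t, Real.exp (-a*t) * h (ρ*t) = 1/(1+ρ) := by
    have e := Measure.integral_comp_div (fun t => Real.exp (-a*t) * h (ρ*t)) ρ
    rw [abs_of_pos hρ, smul_eq_mul] at e
    have e2 : (∫ x : ℝ, Real.exp (-a*(x/ρ)) * h (ρ*(x/ρ))) = ∫ x : ℝ, Real.exp (-(a/ρ)*x) * h x := by
      congr 1
      ext z
      rw [mul_div_cancel₀ _ hρ.ne']
      congr 2
      ring
    rw [← hmom, ← e2, e, ← mul_assoc, one_div_mul_cancel hρ.ne', one_mul]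
  have hω : ∀ t, omegaFn m L ρ (ρ*t) ≤ 0 ∧ omegaFn m L ρ (ρ*t) ≤ m*(t+L) ∧
      omegaFn m L ρ (ρ*t) ≤ -(ρ/2)*(t-L) := by
    intro t
    have e : m/ρ*(ρ*t+L*ρ) = m*(t+L) := by field_simp
    have hm0 : 0 < m := by linarith
    unfold omegaFn
    split_ifs with h1 h2
    · have : t ≤ -L := by
        refine le_of_mul_le_mul_left ?_ hρ
        linarith
      rw [e]
      have q3 : m*(t+L) ≤ 0 := mul_nonpos_of_nonneg_of_nonpos hm0.le (by linarith)
      have q4 : 0 ≤ ρ*(L-t) := mul_nonneg hρ.le (by linarith)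
      refine ⟨q3, le_refl _, by linarith⟩
    · have q1 : -L < t := by
        refine lt_of_mul_lt_mul_left ?_ hρ.le
        linarith
      have q2 : t < L := by
        refine lt_of_mul_lt_mul_left ?_ hρ.le
        linarith
      have q3 : 0 ≤ m*(t+L) := mul_nonneg hm0.le (by linarith)
      have q4 : 0 ≤ ρ*(L-t) := mul_nonneg hρ.le (by linarith)
      refine ⟨le_refl _, q3, by linarith⟩
    · have q2 : L ≤ t := by
        refine le_of_mul_le_mul_left ?_ hρ
        linarith
      have q3 : 0 ≤ m*(t+L) := mul_nonneg hm0.le (by linarith)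
      have q4 : 0 ≤ ρ*(t-L) := mul_nonneg hρ.le (by linarith)
      refine ⟨by linarith, by linarith, by linarith⟩
  have hg1 : ∀ t, |h (ρ*t)| ≤ HDecay.Phi m L t := by
    intro t
    refine (hb _).trans ?_
    unfold HDecay.Phi
    gcongr
    exact le_min (Real.exp_le_one_iff.2 (hω t).1) (Real.exp_le_exp.2 (hω t).2.1)
  have hg2 : ∀ t, |h (ρ*t)| ≤ 2 * Real.exp (-(ρ/2)*(t-L)) := by
    intro t
    refine (hb _).trans ?_
    gcongr
    exact (hω t).2.2
  have hxξ : ρ * (x/ρ) = x := mul_div_cancel₀ _ hρ.ne'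
  have hE : -(1/2)*(x - L*ρ) = -(ρ/2)*(x/ρ-L) := by field_simp
  have hlip' : ∀ τ ∈ Ioo (0:ℝ) 1, |h (ρ*(x/ρ)) - h (ρ*(x/ρ-τ))| ≤
      A * τ * Real.exp (-(ρ/2)*(x/ρ-L)) := by
    rintro τ ⟨h0, h1⟩
    have q := hlip x hx (ρ*τ) ⟨by positivity, by nlinarith⟩
    have hp : 0 < ρ*τ := by positivity
    rw [abs_div, abs_of_pos hp, div_le_iff₀ hp, hE] at q
    rw [mul_sub, hxξ]
    refine q.trans (le_of_eq ?_)
    field_simp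
  obtain ⟨c1, c2⟩ := HDecay.core hK hgm hm1 hA hLpos hρ hρ2 hρδ hρa
    (by rw [le_div_iff₀ hρ]; exact hx) hmom' hg1 hg2 hlip'
  rw [HDecay.link K a ρ h x hρ c1]
  have e4 : ρ*(x/ρ-L) = x - L*ρ := by rw [mul_sub, hxξ]; ring
  rw [e4, hxξ] at c2
  exact c2
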